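/- Let M, K₁, K₂, K₃ be skew-symmetric real 6×6 matrices, λ ∈ ℝ, and g : ℝ × ℝ³ → ℝ continuous. Suppose ξ, η : ℝ × ℝ³ → ℝ⁶ are continuously differentiable and both satisfy M ∂ₜu + K₁ ∂ₓu + K₂ ∂ᵧu + K₃ ∂_z u = λ g u at every point. Set ω = ⟨M ξ, η⟩, κ₁ = ⟨K₁ ξ, η⟩, κ₂ = ⟨K₂ ξ, η⟩, κ₃ = ⟨K₃ ξ, η⟩. Then for all t₀ ≤ t₁, x₀ ≤ x₁, y₀ ≤ y₁, z₀ ≤ z₁: ∫_{z₀}^{z₁}∫_{y₀}^{y₁}∫_{x₀}^{x₁} ω(t₁,x,y,z) dx dy dz + ∫_{z₀}^{z₁}∫_{y₀}^{y₁}∫_{t₀}^{t₁} κ₁(t,x₁,y,z) dt dy dz + ∫_{z₀}^{z₁}∫_{x₀}^{x₁}∫_{t₀}^{t₁} κ₂(t,x,y₁,z) dt dx dz + ∫_{y₀}^{y₁}∫_{x₀}^{x₁}∫_{t₀}^{t₁} κ₃(t,x,y,z₁) dt dx dy = ∫_{z₀}^{z₁}∫_{y₀}^{y₁}∫_{x₀}^{x₁}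 ω(t₀,x,y,z) dx dy dz + ∫_{z₀}^{z₁}∫_{y₀}^{y₁}∫_{t₀}^{t₁} κ₁(t,x₀,y,z) dt dy dz + ∫_{z₀}^{z₁}∫_{x₀}^{x₁}∫_{t₀}^{t₁} κ₂(t,x,y₀,z) dt dx dz + ∫_{y₀}^{y₁}∫_{x₀}^{x₁}∫_{t₀}^{t₁} κ₃(t,x,y,z₀) dt dx dy. -/

import Mathlib

open Matrix

open MeasureTheory intervalIntegral

/-- Interval integration of a jointly continuous function yields a continuous function of the
parameter. -/
theorem continuous_integral_of_continuous_uncurry {X : Type*} [TopologicalSpace X]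
    [FirstCountableTopology X] {f : X → ℝ → ℝ} (a b : ℝ)
    (hf : Continuous fun q : X × ℝ => f q.1 q.2) :
    Continuous fun x => ∫ s in a..b, f x s :=
  continuous_parametric_intervalIntegral_of_continuous' hf a b

/-- Interval integrals of a jointly continuous function commute. -/
theorem integral_comm_of_continuous_uncurry {f : ℝ → ℝ → ℝ} (a b c d : ℝ)
    (hf : Continuous fun q : ℝ × ℝ => f q.1 q.2) :
    ∫ x in a..b, ∫ y in c..d, f x y = ∫ y in c..d, ∫ x in a..b, f x y :=
  intervalIntegral_intervalIntegral_swap <|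
    (hf.continuousOn.integrableOn_compact (isCompact_uIcc.prod isCompact_uIcc)).mono_set
      (Set.prod_mono Set.uIoc_subset_uIcc Set.uIoc_subset_uIcc)

/-- Product rule for the bilinear form `⟨A u, v⟩`. -/
theorem HasDerivAt.mulVec_dotProduct {n : Type*} [Fintype n] (A : Matrix n n ℝ)
    {u v : ℝ → n → ℝ} {u' v' : n → ℝ} {s : ℝ}
    (hu : HasDerivAt u u' s) (hv : HasDerivAt v v' s) :
    HasDerivAt (fun s => A *ᵥ u s ⬝ᵥ v s) (A *ᵥ u' ⬝ᵥ v s + A *ᵥ u s ⬝ᵥ v') s := by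
  rw [hasDerivAt_pi] at hu hv
  have hAu (i : n) : HasDerivAt (fun s => (A *ᵥ u s) i) ((A *ᵥ u') i) s :=
    HasDerivAt.fun_sum fun j _ => (hu j).const_mul (A i j)
  simp only [dotProduct, ← Finset.sum_add_distrib]
  exact HasDerivAt.fun_sum fun i _ => (hAu i).mul (hv i)

/-- A skew-symmetric matrix moves across the dot product with a change of sign. -/
theorem mulVec_dotProduct_of_transpose_eq_neg {n : Type*} [Fintype n] {A : Matrix n n ℝ}
    (hA : Aᵀ = -A) (u v : n → ℝ) : A *ᵥ u ⬝ᵥ v = -(u ⬝ᵥ A *ᵥ v) := by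
  rw [dotProduct_mulVec, ← mulVec_transpose, hA, neg_mulVec, neg_dotProduct, neg_neg]

/-- Additivity of fourfold iterated interval integrals of continuous functions. -/
theorem iteratedIntegral_add {f g : ℝ → ℝ → ℝ → ℝ → ℝ}
    (hf : Continuous fun q : ((ℝ × ℝ) × ℝ) × ℝ => f q.1.1.1 q.1.1.2 q.1.2 q.2)
    (hg : Continuous fun q : ((ℝ × ℝ) × ℝ) × ℝ => g q.1.1.1 q.1.1.2 q.1.2 q.2)
    {a₀ a₁ b₀ b₁ c₀ c₁ d₀ d₁ : ℝ} :
    (∫ a in a₀..a₁, ∫ b in b₀..b₁, ∫ c in c₀..c₁, ∫ d in d₀..d₁, (f a b c d + g a b c d))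
      = (∫ a in a₀..a₁, ∫ b in b₀..b₁, ∫ c in c₀..c₁, ∫ d in d₀..d₁, f a b c d)
        + ∫ a in a₀..a₁, ∫ b in b₀..b₁, ∫ c in c₀..c₁, ∫ d in d₀..d₁, g a b c d := by
  have hf₃ := continuous_integral_of_continuous_uncurry (f := fun q : (ℝ × ℝ) × ℝ =>
    f q.1.1 q.1.2 q.2) d₀ d₁ hf
  have hg₃ := continuous_integral_of_continuous_uncurry (f := fun q : (ℝ × ℝ) × ℝ =>
    g q.1.1 q.1.2 q.2) d₀ d₁ hg
  have hf₂ := continuous_integral_of_continuous_uncurry (f := fun (q : ℝ × ℝ) c =>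
    ∫ d in d₀..d₁, f q.1 q.2 c d) c₀ c₁ hf₃
  have hg₂ := continuous_integral_of_continuous_uncurry (f := fun (q : ℝ × ℝ) c =>
    ∫ d in d₀..d₁, g q.1 q.2 c d) c₀ c₁ hg₃
  have hf₁ := continuous_integral_of_continuous_uncurry (f := fun a b =>
    ∫ c in c₀..c₁, ∫ d in d₀..d₁, f a b c d) b₀ b₁ hf₂
  have hg₁ := continuous_integral_of_continuous_uncurry (f := fun a b =>
    ∫ c in c₀..c₁, ∫ d in d₀..d₁, g a b c d) b₀ b₁ hg₂
  rw [← intervalIntegral.integral_add]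
  rotate_left
  · exact hf₁.intervalIntegrable _ _
  · exact hg₁.intervalIntegrable _ _
  congr! 2 with a
  rw [← intervalIntegral.integral_add]
  rotate_left
  · exact (hf₂.comp (.prodMk_right a)).intervalIntegrable _ _
  · exact (hg₂.comp (.prodMk_right a)).intervalIntegrable _ _
  congr! 2 with b
  rw [← intervalIntegral.integral_add]
  rotate_left
  · exact (hf₃.comp (.prodMk_right (a, b))).intervalIntegrable _ _
  · exact (hg₃.comp (.prodMk_right (a, b))).intervalIntegrable _ _
  congr! 2 with c
  exact intervalIntegral.integral_add ((hf.comp (.prodMk_right ((a, b), c))).intervalIntegrable _ _)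
    ((hg.comp (.prodMk_right ((a, b), c))).intervalIntegrable _ _)

/-- The fundamental theorem of calculus in the last of four variables, integrated over the other
three. -/
theorem integral_sub_integral_face {f f' : ℝ → ℝ → ℝ → ℝ → ℝ}
    (hf : Continuous fun q : ((ℝ × ℝ) × ℝ) × ℝ => f q.1.1.1 q.1.1.2 q.1.2 q.2)
    (hf' : Continuous fun q : ((ℝ × ℝ) × ℝ) × ℝ => f' q.1.1.1 q.1.1.2 q.1.2 q.2)
    (hderiv : ∀ a b c d, HasDerivAt (f a b c) (f' a b c d) d)
    (a₀ a₁ b₀ b₁ c₀ c₁ d₀ d₁ : ℝ) :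
    (∫ a in a₀..a₁, ∫ b in b₀..b₁, ∫ c in c₀..c₁, f a b c d₁)
      - (∫ a in a₀..a₁, ∫ b in b₀..b₁, ∫ c in c₀..c₁, f a b c d₀)
      = ∫ a in a₀..a₁, ∫ b in b₀..b₁, ∫ c in c₀..c₁, ∫ d in d₀..d₁, f' a b c d := by
  have hf₃ (d : ℝ) : Continuous fun q : (ℝ × ℝ) × ℝ => f q.1.1 q.1.2 q.2 d :=
    hf.comp (.prodMk_left d)
  have hf₂ (d : ℝ) := continuous_integral_of_continuous_uncurry (f := fun (q : ℝ × ℝ) c =>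
    f q.1 q.2 c d) c₀ c₁ (hf₃ d)
  have hf₁ (d : ℝ) := continuous_integral_of_continuous_uncurry (f := fun a b =>
    ∫ c in c₀..c₁, f a b c d) b₀ b₁ (hf₂ d)
  rw [← intervalIntegral.integral_sub]
  rotate_left
  · exact (hf₁ _).intervalIntegrable _ _
  · exact (hf₁ _).intervalIntegrable _ _
  congr! 2 with a
  rw [← intervalIntegral.integral_sub]
  rotate_left
  · exact ((hf₂ _).comp (.prodMk_right a)).intervalIntegrable _ _
  · exact ((hf₂ _).comp (.prodMk_right a)).intervalIntegrable _ _
  congr! 2 with b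
  rw [← intervalIntegral.integral_sub]
  rotate_left
  · exact ((hf₃ _).comp (.prodMk_right (a, b))).intervalIntegrable _ _
  · exact ((hf₃ _).comp (.prodMk_right (a, b))).intervalIntegrable _ _
  congr! 2 with c
  exact (integral_eq_sub_of_hasDerivAt (fun d _ => hderiv a b c d)
    ((hf'.comp (.prodMk_right ((a, b), c))).intervalIntegrable _ _)).symm

/-- **Divergence theorem** on a four-dimensional box, in terms of iterated interval integrals, for
a divergence-free field `(F₀, F₁, F₂, F₃)`. -/
theorem integral_faces_eq_of_divergence_eq_zero {F₀ F₁ F₂ F₃ D₀ D₁ D₂ D₃ : ℝ × ℝ × ℝ × ℝ → ℝ}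
    (hF₀ : Continuous F₀) (hF₁ : Continuous F₁) (hF₂ : Continuous F₂) (hF₃ : Continuous F₃)
    (hD₀ : Continuous D₀) (hD₁ : Continuous D₁) (hD₂ : Continuous D₂) (hD₃ : Continuous D₃)
    (h₀ : ∀ t x y z, HasDerivAt (fun s => F₀ (s, x, y, z)) (D₀ (t, x, y, z)) t)
    (h₁ : ∀ t x y z, HasDerivAt (fun s => F₁ (t, s, y, z)) (D₁ (t, x, y, z)) x)
    (h₂ : ∀ t x y z, HasDerivAt (fun s => F₂ (t, x, s, z)) (D₂ (t, x, y, z)) y)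
    (h₃ : ∀ t x y z, HasDerivAt (fun s => F₃ (t, x, y, s)) (D₃ (t, x, y, z)) z)
    (hdiv : ∀ p, D₀ p + D₁ p + D₂ p + D₃ p = 0) (t₀ t₁ x₀ x₁ y₀ y₁ z₀ z₁ : ℝ) :
    (∫ z in z₀..z₁, ∫ y in y₀..y₁, ∫ x in x₀..x₁, F₀ (t₁, x, y, z))
      + (∫ z in z₀..z₁, ∫ y in y₀..y₁, ∫ t in t₀..t₁, F₁ (t, x₁, y, z))
      + (∫ z in z₀..z₁, ∫ x in x₀..x₁, ∫ t in t₀..t₁, F₂ (t, x, y₁, z))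
      + (∫ y in y₀..y₁, ∫ x in x₀..x₁, ∫ t in t₀..t₁, F₃ (t, x, y, z₁))
    = (∫ z in z₀..z₁, ∫ y in y₀..y₁, ∫ x in x₀..x₁, F₀ (t₀, x, y, z))
      + (∫ z in z₀..z₁, ∫ y in y₀..y₁, ∫ t in t₀..t₁, F₁ (t, x₀, y, z))
      + (∫ z in z₀..z₁, ∫ x in x₀..x₁, ∫ t in t₀..t₁, F₂ (t, x, y₀, z))
      + (∫ y in y₀..y₁, ∫ x in x₀..x₁, ∫ t in t₀..t₁, F₃ (t, x, y, z₀)) := by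
  have e₀ := integral_sub_integral_face (f := fun z y x t => F₀ (t, x, y, z))
    (f' := fun z y x t => D₀ (t, x, y, z)) (by fun_prop) (by fun_prop)
    (fun z y x t => h₀ t x y z) z₀ z₁ y₀ y₁ x₀ x₁ t₀ t₁
  have e₁ := integral_sub_integral_face (f := fun z y t x => F₁ (t, x, y, z))
    (f' := fun z y t x => D₁ (t, x, y, z)) (by fun_prop) (by fun_prop)
    (fun z y t x => h₁ t x y z) z₀ z₁ y₀ y₁ t₀ t₁ x₀ x₁
  have e₂ := integral_sub_integral_face (f := fun z x t y => F₂ (t, x, y, z))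
    (f' := fun z x t y => D₂ (t, x, y, z)) (by fun_prop) (by fun_prop)
    (fun z x t y => h₂ t x y z) z₀ z₁ x₀ x₁ t₀ t₁ y₀ y₁
  have e₃ := integral_sub_integral_face (f := fun y x t z => F₃ (t, x, y, z))
    (f' := fun y x t z => D₃ (t, x, y, z)) (by fun_prop) (by fun_prop)
    (fun y x t z => h₃ t x y z) y₀ y₁ x₀ x₁ t₀ t₁ z₀ z₁
  have s₁ : (∫ z in z₀..z₁, ∫ y in y₀..y₁, ∫ t in t₀..t₁, ∫ x in x₀..x₁, D₁ (t, x, y, z))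
      = ∫ z in z₀..z₁, ∫ y in y₀..y₁, ∫ x in x₀..x₁, ∫ t in t₀..t₁, D₁ (t, x, y, z) := by
    congr! 4 with z y
    exact integral_comm_of_continuous_uncurry _ _ _ _ (by fun_prop)
  have s₂ : (∫ z in z₀..z₁, ∫ x in x₀..x₁, ∫ t in t₀..t₁, ∫ y in y₀..y₁, D₂ (t, x, y, z))
      = ∫ z in z₀..z₁, ∫ y in y₀..y₁, ∫ x in x₀..x₁, ∫ t in t₀..t₁, D₂ (t, x, y, z) := by
    congr! 2 with z
    rw [integral_comm_of_continuous_uncurry y₀]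
    · congr! 2 with x
      exact integral_comm_of_continuous_uncurry _ _ _ _ (by fun_prop)
    · exact continuous_integral_of_continuous_uncurry _ _ (by fun_prop)
  have s₃ : (∫ y in y₀..y₁, ∫ x in x₀..x₁, ∫ t in t₀..t₁, ∫ z in z₀..z₁, D₃ (t, x, y, z))
      = ∫ z in z₀..z₁, ∫ y in y₀..y₁, ∫ x in x₀..x₁, ∫ t in t₀..t₁, D₃ (t, x, y, z) := by
    rw [integral_comm_of_continuous_uncurry z₀]
    · congr! 2 with y
      rw [integral_comm_of_continuous_uncurry z₀]
      · congr! 2 with x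
        exact integral_comm_of_continuous_uncurry _ _ _ _ (by fun_prop)
      · exact continuous_integral_of_continuous_uncurry _ _ (by fun_prop)
    · refine continuous_integral_of_continuous_uncurry _ _ ?_
      exact continuous_integral_of_continuous_uncurry _ _ (by fun_prop)
  have hsum : (∫ z in z₀..z₁, ∫ y in y₀..y₁, ∫ x in x₀..x₁, ∫ t in t₀..t₁, D₀ (t, x, y, z))
      + (∫ z in z₀..z₁, ∫ y in y₀..y₁, ∫ x in x₀..x₁, ∫ t in t₀..t₁, D₁ (t, x, y, z))
      + (∫ z in z₀..z₁, ∫ y in y₀..y₁, ∫ x in x₀..x₁, ∫ t in t₀..t₁, D₂ (t, x, y, z))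
      + (∫ z in z₀..z₁, ∫ y in y₀..y₁, ∫ x in x₀..x₁, ∫ t in t₀..t₁, D₃ (t, x, y, z)) = 0 := by
    rw [← iteratedIntegral_add (by fun_prop) (by fun_prop),
      ← iteratedIntegral_add (by fun_prop) (by fun_prop),
      ← iteratedIntegral_add (by fun_prop) (by fun_prop)]
    simp [hdiv]
  linarith

/-- **Multi-symplectic conservation law (integral/box form).**
For a pair of `C¹` solutions `ξ, η` of the variational equation
`M ∂ₜu + K₁ ∂ₓu + K₂ ∂ᵧu + K₃ ∂_z u = λ g u` with skew-symmetric `M, Kᵢ` and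
continuous `g`, the box integrals of the density `ω = ⟨Mξ,η⟩` and the fluxes
`κᵢ = ⟨Kᵢξ,η⟩` balance over any space-time box. -/
theorem multisymplectic_conservation_law_integral
    (M K₁ K₂ K₃ : Matrix (Fin 6) (Fin 6) ℝ)
    (hM : Mᵀ = -M) (hK₁ : K₁ᵀ = -K₁) (hK₂ : K₂ᵀ = -K₂) (hK₃ : K₃ᵀ = -K₃)
    (lam : ℝ) (g : ℝ × ℝ × ℝ × ℝ → ℝ) (hg : Continuous g)
    (ξ η : ℝ × ℝ × ℝ × ℝ → (Fin 6 → ℝ))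
    (hξ : ContDiff ℝ 1 ξ) (hη : ContDiff ℝ 1 η)
    (hξeq : ∀ p : ℝ × ℝ × ℝ × ℝ,
      M.mulVec (fderiv ℝ ξ p (1, 0, 0, 0)) + K₁.mulVec (fderiv ℝ ξ p (0, 1, 0, 0))
        + K₂.mulVec (fderiv ℝ ξ p (0, 0, 1, 0)) + K₃.mulVec (fderiv ℝ ξ p (0, 0, 0, 1))
        = (lam * g p) • ξ p)
    (hηeq : ∀ p : ℝ × ℝ × ℝ × ℝ,
      M.mulVec (fderiv ℝ η p (1, 0, 0, 0)) + K₁.mulVec (fderiv ℝ η p (0, 1, 0, 0))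
        + K₂.mulVec (fderiv ℝ η p (0, 0, 1, 0)) + K₃.mulVec (fderiv ℝ η p (0, 0, 0, 1))
        = (lam * g p) • η p)
    (t₀ t₁ x₀ x₁ y₀ y₁ z₀ z₁ : ℝ)
    (ht : t₀ ≤ t₁) (hx : x₀ ≤ x₁) (hy : y₀ ≤ y₁) (hz : z₀ ≤ z₁) :
    (∫ z in z₀..z₁, ∫ y in y₀..y₁, ∫ x in x₀..x₁,
        M.mulVec (ξ (t₁, x, y, z)) ⬝ᵥ η (t₁, x, y, z))
      + (∫ z in z₀..z₁, ∫ y in y₀..y₁, ∫ t in t₀..t₁,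
          K₁.mulVec (ξ (t, x₁, y, z)) ⬝ᵥ η (t, x₁, y, z))
      + (∫ z in z₀..z₁, ∫ x in x₀..x₁, ∫ t in t₀..t₁,
          K₂.mulVec (ξ (t, x, y₁, z)) ⬝ᵥ η (t, x, y₁, z))
      + (∫ y in y₀..y₁, ∫ x in x₀..x₁, ∫ t in t₀..t₁,
          K₃.mulVec (ξ (t, x, y, z₁)) ⬝ᵥ η (t, x, y, z₁))
    = (∫ z in z₀..z₁, ∫ y in y₀..y₁, ∫ x in x₀..x₁,
        M.mulVec (ξ (t₀, x, y, z)) ⬝ᵥ η (t₀, x, y, z))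
      + (∫ z in z₀..z₁, ∫ y in y₀..y₁, ∫ t in t₀..t₁,
          K₁.mulVec (ξ (t, x₀, y, z)) ⬝ᵥ η (t, x₀, y, z))
      + (∫ z in z₀..z₁, ∫ x in x₀..x₁, ∫ t in t₀..t₁,
          K₂.mulVec (ξ (t, x, y₀, z)) ⬝ᵥ η (t, x, y₀, z))
      + (∫ y in y₀..y₁, ∫ x in x₀..x₁, ∫ t in t₀..t₁,
          K₃.mulVec (ξ (t, x, y, z₀)) ⬝ᵥ η (t, x, y, z₀)) := by
  have hξ' (v : ℝ × ℝ × ℝ × ℝ) : Continuous fun p => fderiv ℝ ξ p v :=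
    (hξ.continuous_fderiv one_ne_zero).clm_apply continuous_const
  have hη' (v : ℝ × ℝ × ℝ × ℝ) : Continuous fun p => fderiv ℝ η p v :=
    (hη.continuous_fderiv one_ne_zero).clm_apply continuous_const
  have hF (A : Matrix (Fin 6) (Fin 6) ℝ) : Continuous fun p => A *ᵥ ξ p ⬝ᵥ η p :=
    (continuous_const.matrix_mulVec hξ.continuous).dotProduct hη.continuous
  have hD (A : Matrix (Fin 6) (Fin 6) ℝ) (v : ℝ × ℝ × ℝ × ℝ) :
      Continuous fun p => A *ᵥ fderiv ℝ ξ p v ⬝ᵥ η p + A *ᵥ ξ p ⬝ᵥ fderiv ℝ η p v :=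
    ((continuous_const.matrix_mulVec (hξ' v)).dotProduct hη.continuous).add
      ((continuous_const.matrix_mulVec hξ.continuous).dotProduct (hη' v))
  have hderiv (A : Matrix (Fin 6) (Fin 6) ℝ) {γ : ℝ → ℝ × ℝ × ℝ × ℝ} {v : ℝ × ℝ × ℝ × ℝ} {s : ℝ}
      (hγ : HasDerivAt γ v s) : HasDerivAt (fun s => A *ᵥ ξ (γ s) ⬝ᵥ η (γ s))
        (A *ᵥ fderiv ℝ ξ (γ s) v ⬝ᵥ η (γ s) + A *ᵥ ξ (γ s) ⬝ᵥ fderiv ℝ η (γ s) v) s :=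
    .mulVec_dotProduct A
      ((hξ.differentiable one_ne_zero (γ s)).hasFDerivAt.comp_hasDerivAt s hγ)
      ((hη.differentiable one_ne_zero (γ s)).hasFDerivAt.comp_hasDerivAt s hγ)
  refine integral_faces_eq_of_divergence_eq_zero (hF M) (hF K₁) (hF K₂) (hF K₃)
    (hD M (1, 0, 0, 0)) (hD K₁ (0, 1, 0, 0)) (hD K₂ (0, 0, 1, 0)) (hD K₃ (0, 0, 0, 1))
    (fun t x y z => hderiv M ((hasDerivAt_id t).prodMk (hasDerivAt_const t (x, y, z))))
    (fun t x y z => hderiv K₁ ((hasDerivAt_const x t).prodMk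
      ((hasDerivAt_id x).prodMk (hasDerivAt_const x (y, z)))))
    (fun t x y z => hderiv K₂ ((hasDerivAt_const y t).prodMk
      ((hasDerivAt_const y x).prodMk ((hasDerivAt_id y).prodMk (hasDerivAt_const y z)))))
    (fun t x y z => hderiv K₃ ((hasDerivAt_const z t).prodMk
      ((hasDerivAt_const z x).prodMk ((hasDerivAt_const z y).prodMk (hasDerivAt_id z)))))
    (fun p => ?_) t₀ t₁ x₀ x₁ y₀ y₁ z₀ z₁
  have h₁ := congrArg (· ⬝ᵥ η p) (hξeq p)
  have h₂ := congrArg (ξ p ⬝ᵥ ·) (hηeq p)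
  simp only [add_dotProduct, dotProduct_add, smul_dotProduct, dotProduct_smul] at h₁ h₂
  simp only [mulVec_dotProduct_of_transpose_eq_neg hM (ξ p),
    mulVec_dotProduct_of_transpose_eq_neg hK₁ (ξ p),
    mulVec_dotProduct_of_transpose_eq_neg hK₂ (ξ p),
    mulVec_dotProduct_of_transpose_eq_neg hK₃ (ξ p)]
  linarith
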